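/- arXiv:2510.25924 — 2 statements merged into one kernel-verified Lean document; each statement's English description precedes it below -/
import Mathlib

section
/- Let B be an invertible real k × k matrix, M a real k × l matrix, and set C := B·M. Assume the Gram matrix C·Cᵀ is invertible and let C† := Cᵀ·(C·Cᵀ)⁻¹ be its right pseudoinverse. Then for every row vector a ∈ ℝ^k, one has (aᵀ·M)·C†·B = aᵀ, where aᵀ·M denotes the row vector obtained by multiplying a on the right by M. -/
/-- **Recovery identity (Equation (12)).** Let `B` be an invertible `k × k` matrix,
`M` a `k × l` matrix and `C := B * M`. If the Gram matrix `C * Cᵀ` is invertible and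
`C† := Cᵀ * (C * Cᵀ)⁻¹` denotes the right pseudoinverse, then for every row vector
`a ∈ ℝ^k` we have `(aᵀ · M) · C† · B = aᵀ`. -/
theorem stmt_4 {k l : ℕ} (B : Matrix (Fin k) (Fin k) ℝ) (M : Matrix (Fin k) (Fin l) ℝ)
    (hB : IsUnit B)
    (hGram : IsUnit ((B * M) * (B * M).transpose))
    (a : Fin k → ℝ) :
    Matrix.vecMul
      (Matrix.vecMul (Matrix.vecMul a M)
        ((B * M).transpose * ((B * M) * (B * M).transpose)⁻¹)) B = a := by
  have h : B * (M * ((B * M).transpose * ((B * M) * (B * M).transpose)⁻¹)) = 1 := by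
    rw [← Matrix.mul_assoc, ← Matrix.mul_assoc]
    exact Matrix.mul_nonsing_inv _ ((Matrix.isUnit_iff_isUnit_det _).mp hGram)
  rw [Matrix.vecMul_vecMul, Matrix.vecMul_vecMul, ← Matrix.mul_assoc M, mul_eq_one_comm.mp h, Matrix.vecMul_one]
end

section
/- Let A be a real m × n matrix all of whose entries are nonnegative, and let r := rank(A) with r ≥ 1. Then there exists a surjective map σ : Fin m → Fin r such that the r × n matrix B defined by B_{j,·} = Σ_{i : σ(i) = j} A_{i,·} (the sum of the rows of A merged into group j) has rank r, i.e., its rows are linearly independent. -/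
open Module Submodule in
/-- If `v` is a nonempty linearly independent family of nonnegative vectors, then any nonnegative
vector in its span can be added to some member of `v` preserving linear independence. -/
theorem LinearIndependent.exists_add_single_of_nonneg {κ E : Type*} [Fintype κ] [DecidableEq κ]
    [Nonempty κ] [AddCommGroup E] [PartialOrder E] [IsOrderedAddMonoid E] [Module ℝ E]
    {v : κ → E} (hv : LinearIndependent ℝ v) (hv0 : ∀ j, 0 ≤ v j) {x : E} (hx0 : 0 ≤ x)
    (hx : x ∈ span ℝ (Set.range v)) :
    ∃ j, LinearIndependent ℝ (fun k => v k + if j = k then x else 0) := by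
  obtain ⟨c, rfl⟩ := (mem_span_range_iff_exists_fun ℝ).1 hx
  have hc : ∃ j, c j ≠ -1 := by
    by_contra! h
    simp only [h, neg_smul, one_smul, Finset.sum_neg_distrib, Left.nonneg_neg_iff] at hx0
    obtain ⟨j⟩ := ‹Nonempty κ›
    exact hv.ne_zero j <| le_antisymm
      ((Finset.single_le_sum (fun i _ => hv0 i) (Finset.mem_univ j)).trans hx0) (hv0 j)
  obtain ⟨j, hj⟩ := hc
  refine ⟨j, Fintype.linearIndependent_iff.2 fun g hg => ?_⟩
  have key : ∀ k, g k + g j * c k = 0 := by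
    refine Fintype.linearIndependent_iff.1 hv _ ?_
    simpa [add_smul, mul_smul, Finset.sum_add_distrib, smul_ite, ← Finset.smul_sum] using hg
  have hgj : g j = 0 := by
    have h : g j * (1 + c j) = 0 := by linear_combination key j
    exact (mul_eq_zero.1 h).resolve_right fun h => hj (by linarith)
  simpa [hgj] using key

open Module Submodule in
/-- A finite family of nonnegative vectors spanning a space of dimension `card κ`, and containing
a linearly independent subfamily indexed by `κ`, can be partitioned into groups indexed by `κ`
whose sums are linearly independent. -/
theorem exists_surjective_linearIndependent_sum_fiber {ι κ E : Type*} [Fintype ι] [Fintype κ]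
    [DecidableEq κ] [Nonempty κ] [AddCommGroup E] [PartialOrder E] [IsOrderedAddMonoid E]
    [Module ℝ E] {a : ι → E} (ha : ∀ i, 0 ≤ a i)
    (hcard : finrank ℝ (span ℝ (Set.range a)) = Fintype.card κ)
    {f : κ → ι} (hf : LinearIndependent ℝ (a ∘ f)) :
    ∃ σ : ι → κ, Function.Surjective σ ∧
      LinearIndependent ℝ (fun j => ∑ i ∈ Finset.univ.filter (fun i => σ i = j), a i) := by
  classical
  have hfinj : Function.Injective f := hf.injective.of_comp
  have key : ∀ t : Finset ι, ∃ σ : ι → κ, LinearIndependent ℝ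
      (fun j => ∑ i ∈ (t ∪ Finset.univ.image f).filter (fun i => σ i = j), a i) := by
    intro t
    induction t using Finset.induction_on with
    | empty =>
      refine ⟨Function.invFun f, ?_⟩
      convert hf using 2 with j
      rw [Finset.empty_union, Finset.sum_filter, Finset.sum_image hfinj.injOn]
      simp [Function.leftInverse_invFun hfinj _]
    | insert i t _ ih =>
      obtain ⟨σ, hσ⟩ := ih
      rw [Finset.insert_union]
      by_cases hi : i ∈ t ∪ Finset.univ.image f
      · exact ⟨σ, by rwa [Finset.insert_eq_of_mem hi]⟩
      have hspan : a i ∈ span ℝ (Set.range fun j =>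
          ∑ i ∈ (t ∪ Finset.univ.image f).filter (fun i => σ i = j), a i) := by
        have := FiniteDimensional.span_of_finite ℝ (Set.finite_range a)
        refine (eq_of_le_of_finrank_le (S₂ := span ℝ (Set.range a)) (span_le.2 ?_)
          (by rw [hcard, finrank_span_eq_card hσ])).ge (subset_span ⟨i, rfl⟩)
        rintro _ ⟨j, rfl⟩
        exact sum_mem fun k _ => subset_span ⟨k, rfl⟩
      obtain ⟨j, hj⟩ := hσ.exists_add_single_of_nonneg
        (fun j => Finset.sum_nonneg fun i _ => ha i) (ha i) hspan
      refine ⟨Function.update σ i j, ?_⟩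
      convert hj using 2 with k
      rw [Finset.sum_filter, Finset.sum_insert hi, Function.update_self, add_comm,
        Finset.sum_filter]
      congr 1
      refine Finset.sum_congr rfl fun l hl => ?_
      rw [Function.update_of_ne (ne_of_mem_of_not_mem hl hi)]
  obtain ⟨σ, hσ⟩ := key Finset.univ
  rw [Finset.union_eq_left.2 (Finset.subset_univ _)] at hσ
  refine ⟨σ, fun j => ?_, hσ⟩
  obtain ⟨i, hi, -⟩ := Finset.exists_ne_zero_of_sum_ne_zero (hσ.ne_zero j)
  exact ⟨i, (Finset.mem_filter.1 hi).2⟩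

/-- **Core of Proposition A.1.** A nonnegative real `m × n` matrix `A` of rank `r ≥ 1`
admits a surjective grouping `σ : Fin m → Fin r` of its rows such that the `r × n`
matrix whose `j`-th row is the sum of the rows of `A` in group `j` has rank `r`
(i.e., linearly independent rows). -/
theorem stmt_10 {m n : ℕ} (A : Matrix (Fin m) (Fin n) ℝ)
    (hA : ∀ i j, 0 ≤ A i j) (hr : 1 ≤ A.rank) :
    ∃ σ : Fin m → Fin A.rank, Function.Surjective σ ∧
      (Matrix.of fun j : Fin A.rank => ∑ i ∈ Finset.univ.filter (fun i => σ i = j), A i).rank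
        = A.rank := by
  have : Nonempty (Fin A.rank) := ⟨⟨0, hr⟩⟩
  have hrank := A.rank_eq_finrank_span_row
  obtain ⟨g, hg, -, hgli⟩ := Submodule.exists_fun_fin_finrank_span_eq ℝ (Set.range A.row)
  choose f hf using hg
  have hli : LinearIndependent ℝ (A.row ∘ f ∘ finCongr hrank) := by
    rw [← Function.comp_assoc, show A.row ∘ f = g from funext hf]
    exact hgli.comp _ (finCongr hrank).injective
  obtain ⟨σ, hσ, hσli⟩ := exists_surjective_linearIndependent_sum_fiber
    (a := A.row) (fun i j => hA i j) (by rw [Fintype.card_fin, hrank]) hli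
  exact ⟨σ, hσ, (LinearIndependent.rank_matrix (M := Matrix.of _) hσli).trans (Fintype.card_fin _)⟩
end
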